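/- Fix i ∈ {1,…,n} and a set Γ of nPC formulas, and for each j ∈ {1,…,n} let I_j = { [F] : the sequent Γ ⊢_i F^{(ij)} is provable in nPC }. Then the n-tuple (I_1,…,I_n) of subsets of the Lindenbaum algebra L_n satisfies the multideal conditions: (m1) [e_j] ∈ I_j for every j; (m2) if [F] ∈ I_j, [G] ∈ I_k, and H_1,…,H_n are any formulas, then [q(G, H_1, …, H_{k−1}, F, H_{k+1}, …, H_n)] ∈ I_j; (m3) if G is any formula and [F_1],…,[F_n] ∈ I_j, then [q(G, F_1, …, F_n)] ∈ I_j. Moreover every formula of Γ has its class in I_i. -/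

import Mathlib

/-- Formulas of the n-dimensional propositional calculus nPC:
decorated variables `X^π`, constants `e_k`, and compounds `q(F,G_1,…,G_n)`.
Dimensions are elements of `Fin n`; propositional variables are natural numbers. -/
inductive Fm (n : ℕ) : Type where
  | var (X : ℕ) (π : Equiv.Perm (Fin n)) : Fm n
  | const (k : Fin n) : Fm n
  | q (F : Fm n) (G : Fin n → Fm n) : Fm n

/-- The action `F^ρ` of a permutation `ρ` on a formula. -/
def Fm.act {n : ℕ} (ρ : Equiv.Perm (Fin n)) : Fm n → Fm n
  | .var X π => .var X (ρ * π)
  | .const k => .const (ρ k)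
  | .q F G => .q F (fun j => (G j).act ρ)

/-- The action of a permutation on a multiset of formulas (context). -/
def actM {n : ℕ} (ρ : Equiv.Perm (Fin n)) (Γ : Multiset (Fm n)) : Multiset (Fm n) :=
  Γ.map (Fm.act ρ)

/-- The sequent calculus of nPC: `Proves Γ i Δ` means the sequent `Γ ⊢_i Δ` is provable. -/
inductive Proves {n : ℕ} : Multiset (Fm n) → Fin n → Multiset (Fm n) → Prop where
  | const (i : Fin n) : Proves 0 i {Fm.const i}
  | id (X : ℕ) (π ρ : Equiv.Perm (Fin n)) (i : Fin n) (h : π⁻¹ i = ρ⁻¹ i) :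
      Proves {Fm.var X π} i {Fm.var X ρ}
  | sym (Γ Δ : Multiset (Fm n)) (i j : Fin n)
      (h : Proves (actM (Equiv.swap i j) Γ) i (actM (Equiv.swap i j) Δ)) :
      Proves Γ j Δ
  | neg1 (Γ Δ : Multiset (Fm n)) (F : Fm n) (i j k : Fin n) (hik : i ≠ k)
      (h : Proves (actM (Equiv.swap i j) Γ) i (F ::ₘ actM (Equiv.swap i j) Δ)) :
      Proves (F.act (Equiv.swap j k) ::ₘ Γ) j Δ
  | neg2 (Γ Δ : Multiset (Fm n)) (F : Fm n) (i j k : Fin n) (hjk : j ≠ k)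
      (h : Proves (actM (Equiv.swap i j) Γ) i (F ::ₘ actM (Equiv.swap i j) Δ)) :
      Proves (F.act (Equiv.swap i k) ::ₘ Γ) j Δ
  | neg3 (Γ Δ : Multiset (Fm n)) (F : Fm n) (j : Fin n)
      (h : ∀ i : Fin n, i ≠ j →
        Proves (F ::ₘ actM (Equiv.swap i j) Γ) i (actM (Equiv.swap i j) Δ)) :
      Proves Γ j (F ::ₘ Δ)
  | qL (Γ Δ : Multiset (Fm n)) (F : Fm n) (G : Fin n → Fm n) (i : Fin n)
      (h : ∀ j : Fin n,
        Proves ((G j).act (Equiv.swap j i) ::ₘ F ::ₘ actM (Equiv.swap j i) Γ) j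
          (actM (Equiv.swap j i) Δ)) :
      Proves (Fm.q F G ::ₘ Γ) i Δ
  | qR (Γ Δ : Multiset (Fm n)) (F : Fm n) (G : Fin n → Fm n) (i : Fin n)
      (h : ∀ j : Fin n,
        Proves (F ::ₘ actM (Equiv.swap j i) Γ) j
          ((G j).act (Equiv.swap j i) ::ₘ actM (Equiv.swap j i) Δ)) :
      Proves Γ i (Fm.q F G ::ₘ Δ)
  | cut (Γ Δ : Multiset (Fm n)) (F : Fm n) (i : Fin n)
      (h1 : Proves (F ::ₘ Γ) i Δ) (h2 : Proves Γ i (F ::ₘ Δ)) : Proves Γ i Δ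
  | weakL (Γ Δ : Multiset (Fm n)) (F : Fm n) (i : Fin n)
      (h : Proves Γ i Δ) : Proves (F ::ₘ Γ) i Δ
  | weakR (Γ Δ : Multiset (Fm n)) (F : Fm n) (i : Fin n)
      (h : Proves Γ i Δ) : Proves Γ i (F ::ₘ Δ)
  | conL (Γ Δ : Multiset (Fm n)) (F : Fm n) (i : Fin n)
      (h : Proves (F ::ₘ F ::ₘ Γ) i Δ) : Proves (F ::ₘ Γ) i Δ
  | conR (Γ Δ : Multiset (Fm n)) (F : Fm n) (i : Fin n)
      (h : Proves Γ i (F ::ₘ F ::ₘ Δ)) : Proves Γ i (F ::ₘ Δ)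

/-- The semantics `⟦F⟧v` of a formula in an environment `v`. -/
def Fm.sem {n : ℕ} (v : ℕ → Fin n) : Fm n → Fin n
  | .var X π => π (v X)
  | .const k => k
  | .q F G => (G (F.sem v)).sem v

/-- `Γ ⊨_i Δ`: every environment making all of `Γ` equal `i` makes some formula of `Δ` equal `i`. -/
def Models {n : ℕ} (Γ : Multiset (Fm n)) (i : Fin n) (Δ : Multiset (Fm n)) : Prop :=
  ∀ v : ℕ → Fin n, (∀ G ∈ Γ, Fm.sem v G = i) → ∃ F ∈ Δ, Fm.sem v F = i

/-- Logical equivalence `F ∼ G`: both `F ⊢_i G` and `G ⊢_i F` are provable for every `i`. -/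
def Eqv {n : ℕ} (F G : Fm n) : Prop :=
  ∀ i : Fin n, Proves {F} i {G} ∧ Proves {G} i {F}

/-- Provability from a (possibly infinite) set of hypotheses:
some finite sub-multiset of `Γ` proves `Δ` at `i`. -/
def ProvesSet {n : ℕ} (Γ : Set (Fm n)) (i : Fin n) (Δ : Multiset (Fm n)) : Prop :=
  ∃ Γ' : Multiset (Fm n), (∀ G ∈ Γ', G ∈ Γ) ∧ Proves Γ' i Δ

/-- `Γ ⊨_i F` for a set `Γ` of hypotheses. -/
def ModelsSet {n : ℕ} (Γ : Set (Fm n)) (i : Fin n) (F : Fm n) : Prop :=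
  ∀ v : ℕ → Fin n, (∀ G ∈ Γ, Fm.sem v G = i) → Fm.sem v F = i

theorem Fm.act_act {n : ℕ} (σ ρ : Equiv.Perm (Fin n)) (F : Fm n) :
    (F.act ρ).act σ = F.act (σ * ρ) := by
  induction F with
  | var X π => simp [Fm.act, mul_assoc]
  | const k => simp [Fm.act]
  | q F G _ ihG => simp [Fm.act, ihG]

theorem Fm.act_one {n : ℕ} (F : Fm n) : F.act 1 = F := by
  induction F with
  | var X π => simp [Fm.act]
  | const k => simp [Fm.act]
  | q F G _ ihG => simp [Fm.act, ihG]

theorem Fm.act_swap_act_swap {n : ℕ} (i j : Fin n) (F : Fm n) :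
    (F.act (Equiv.swap i j)).act (Equiv.swap i j) = F := by
  rw [Fm.act_act, Equiv.swap_mul_self, Fm.act_one]

theorem actM_swap_actM_swap {n : ℕ} (i j : Fin n) (Γ : Multiset (Fm n)) :
    actM (Equiv.swap i j) (actM (Equiv.swap i j) Γ) = Γ := by
  simp [actM, Fm.act_swap_act_swap]

theorem actM_singleton {n : ℕ} (ρ : Equiv.Perm (Fin n)) (F : Fm n) :
    actM ρ {F} = {F.act ρ} :=
  Multiset.map_singleton _ _

theorem actM_one {n : ℕ} (Γ : Multiset (Fm n)) : actM 1 Γ = Γ := by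
  simp [actM, Fm.act_one]

namespace Proves

variable {n : ℕ}

theorem add_left {Γ Δ : Multiset (Fm n)} {i : Fin n} (h : Proves Γ i Δ)
    (Θ : Multiset (Fm n)) : Proves (Θ + Γ) i Δ := by
  induction Θ using Multiset.induction with
  | empty => simpa using h
  | cons F Θ ih => simpa using weakL _ _ F _ ih

theorem mono_left {Γ Γ' Δ : Multiset (Fm n)} {i : Fin n} (hle : Γ ≤ Γ')
    (h : Proves Γ i Δ) : Proves Γ' i Δ := by
  obtain ⟨Θ, rfl⟩ := Multiset.le_iff_exists_add.1 hle
  rw [add_comm]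
  exact h.add_left Θ

theorem add_right {Γ Δ : Multiset (Fm n)} {i : Fin n} (h : Proves Γ i Δ)
    (Θ : Multiset (Fm n)) : Proves Γ i (Θ + Δ) := by
  induction Θ using Multiset.induction with
  | empty => simpa using h
  | cons F Θ ih => simpa using weakR _ _ F _ ih

/-- The converse reading of the rule `sym`. -/
theorem actM_swap {Γ Δ : Multiset (Fm n)} {i : Fin n} (h : Proves Γ i Δ) (j : Fin n) :
    Proves (actM (Equiv.swap j i) Γ) j (actM (Equiv.swap j i) Δ) := by
  apply sym _ _ i j
  rwa [Equiv.swap_comm i j, actM_swap_actM_swap, actM_swap_actM_swap]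

theorem trans {Γ : Multiset (Fm n)} {F G : Fm n} {i : Fin n} (h : Proves Γ i {F})
    (h' : Proves {F} i {G}) : Proves Γ i {G} := by
  refine cut Γ {G} F i (h'.mono_left (by simp)) ?_
  rw [show F ::ₘ {G} = G ::ₘ {F} from Multiset.pair_comm F G]
  exact weakR _ _ G _ h

/-- If `Γ` forces `G` to take the value `k`, then `G` cannot take the value `l ≠ k`. -/
theorem neg_of_ne {Γ : Multiset (Fm n)} {G : Fm n} {i k l : Fin n} (hlk : l ≠ k)
    (h : Proves Γ i {G.act (Equiv.swap i k)}) :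
    Proves (G ::ₘ actM (Equiv.swap l i) Γ) l 0 := by
  have := neg2 (actM (Equiv.swap l i) Γ) 0 (G.act (Equiv.swap i k)) i l k hlk
    (by rw [Equiv.swap_comm i l, actM_swap_actM_swap]; exact h)
  rwa [Fm.act_swap_act_swap] at this

protected theorem refl (F : Fm n) (i : Fin n) : Proves {F} i {F} := by
  induction F generalizing i with
  | var X π => exact id X π π i rfl
  | const k =>
    by_cases hik : i = k
    · subst hik
      exact weakL _ _ _ _ (const i)
    · have h : Proves (0 : Multiset (Fm n)) i {(Fm.const k).act (Equiv.swap i k)} := by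
        simpa [Fm.act] using const i
      have := (neg_of_ne hik h).add_right {Fm.const k}
      simpa [actM] using this
  | q F G ihF ihG =>
    refine qL 0 _ F G i fun j => ?_
    rw [actM_singleton]
    refine qR _ 0 F _ j fun k => ?_
    by_cases hkj : k = j
    · subst hkj
      rw [Equiv.swap_self]
      have h := (ihG k i).actM_swap k
      rw [actM_singleton] at h
      change Proves (F ::ₘ actM 1 _) k {((G k).act (Equiv.swap k i)).act 1}
      rw [actM_one, Fm.act_one]
      exact h.mono_left (by simp)
    · have h : Proves {F} j {F.act (Equiv.swap j j)} := by
        rw [Equiv.swap_self]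
        change Proves {F} j {F.act 1}
        rw [Fm.act_one]
        exact ihF j
      have h' := (neg_of_ne hkj h).add_right {((G k).act (Equiv.swap j i)).act (Equiv.swap k j)}
      refine mono_left ?_ h'
      rw [actM_singleton]
      simp [actM]

end Proves

theorem Eqv.equivalence (n : ℕ) : Equivalence (@Eqv n) where
  refl F i := ⟨Proves.refl F i, Proves.refl F i⟩
  symm h i := (h i).symm
  trans h h' i := ⟨(h i).1.trans (h' i).1, (h' i).2.trans (h i).2⟩

theorem Quot.mk_eqv_eq_iff {n : ℕ} {F G : Fm n} :
    Quot.mk (@Eqv n) F = Quot.mk (@Eqv n) G ↔ Eqv F G := by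
  rw [Quot.eq, (Eqv.equivalence n).eqvGen_iff]

/-- Membership of a class in `I_j` does not depend on the representative. -/
theorem mk_mem_iff_provesSet {n : ℕ} {i j : Fin n} {Γ : Set (Fm n)} {F : Fm n} :
    (∃ F' : Fm n, Quot.mk (@Eqv n) F = Quot.mk (@Eqv n) F' ∧
      ProvesSet Γ i {Fm.act (Equiv.swap i j) F'}) ↔
    ProvesSet Γ i {Fm.act (Equiv.swap i j) F} := by
  refine ⟨?_, fun h => ⟨F, rfl, h⟩⟩
  rintro ⟨F', hF, Γ', hΓ', h⟩
  refine ⟨Γ', hΓ', h.trans ?_⟩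
  simpa only [actM_singleton] using ((Quot.mk_eqv_eq_iff.1 hF j).2).actM_swap i

/-- Fix `i` and a set `Γ` of formulas; for each `j` let
`I_j = { [F] : Γ ⊢_i F^{(ij)} }` as a subset of the Lindenbaum algebra `L_n = F_n/∼`.
Then `(I_1,…,I_n)` satisfies the multideal conditions (m1)–(m3), and every formula
of `Γ` has its class in `I_i`. -/
theorem gamma_multideal (n : ℕ) (hn : 2 ≤ n) (i : Fin n) (Γ : Set (Fm n)) :
    let I : Fin n → Set (Quot (@Eqv n)) := fun j =>
      { x | ∃ F : Fm n, x = Quot.mk (@Eqv n) F ∧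
              ProvesSet Γ i {Fm.act (Equiv.swap i j) F} }
    -- (m1)
    (∀ j : Fin n, Quot.mk (@Eqv n) (Fm.const j) ∈ I j) ∧
    -- (m2)
    (∀ (j k : Fin n) (F G : Fm n) (H : Fin n → Fm n),
      Quot.mk (@Eqv n) F ∈ I j → Quot.mk (@Eqv n) G ∈ I k →
      Quot.mk (@Eqv n) (Fm.q G (Function.update H k F)) ∈ I j) ∧
    -- (m3)
    (∀ (j : Fin n) (G : Fm n) (Fs : Fin n → Fm n),
      (∀ r : Fin n, Quot.mk (@Eqv n) (Fs r) ∈ I j) →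
      Quot.mk (@Eqv n) (Fm.q G Fs) ∈ I j) ∧
    -- hypotheses are in I_i
    (∀ F ∈ Γ, Quot.mk (@Eqv n) F ∈ I i) := by
  intro I
  have hI : ∀ (j : Fin n) (F : Fm n),
      Quot.mk (@Eqv n) F ∈ I j ↔ ProvesSet Γ i {Fm.act (Equiv.swap i j) F} :=
    fun j F => mk_mem_iff_provesSet
  simp only [hI]
  refine ⟨fun j => ⟨0, by simp, by simpa [Fm.act] using Proves.const i⟩, ?_, ?_, ?_⟩
  · rintro j k F G H ⟨Γ₁, hΓ₁, hF⟩ ⟨Γ₂, hΓ₂, hG⟩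
    refine ⟨Γ₁ + Γ₂, fun A hA => (Multiset.mem_add.1 hA).elim (hΓ₁ A) (hΓ₂ A), ?_⟩
    refine Proves.qR _ 0 _ _ i fun l => ?_
    by_cases hlk : l = k
    · subst hlk
      rw [Function.update_self]
      have h := (hF.mono_left (Multiset.le_add_right Γ₁ Γ₂)).actM_swap l
      rw [actM_singleton] at h
      exact Proves.weakL _ _ _ _ h
    · exact (Proves.neg_of_ne hlk (hG.mono_left (Multiset.le_add_left Γ₂ Γ₁))).add_right {_}
  · intro j G Fs h
    choose Γs hΓs hFs using h
    refine ⟨∑ r, Γs r, fun A hA => ?_, ?_⟩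
    · obtain ⟨r, -, hr⟩ := Multiset.mem_sum.1 hA
      exact hΓs r A hr
    · refine Proves.qR _ 0 _ _ i fun l => Proves.weakL _ _ _ _ ?_
      have hle : Γs l ≤ ∑ r, Γs r :=
        Finset.single_le_sum (fun r _ => Multiset.zero_le (Γs r)) (Finset.mem_univ l)
      have h := ((hFs l).mono_left hle).actM_swap l
      rwa [actM_singleton] at h
  · intro F hF
    refine ⟨{F}, by simpa using hF, ?_⟩
    rw [Equiv.swap_self]
    change Proves {F} i {F.act 1}
    rw [Fm.act_one]
    exact Proves.refl F i
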